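/- With X, Y, f, e, M', M'' as in the context, and assuming in addition that for every r ≥ 0 one has sup{d_X(f(x), f(y)) : x, y ∈ Y, d_Y(x, y) ≤ r} < ∞: M'(N) → ∞ as N → ∞ if and only if M''(N) → ∞ as N → ∞ (limits taken in [0,∞]). -/

import Mathlib

open Filter ENNReal

/-- The Gromov product `(a·b)_e` in a metric space. -/
noncomputable def gromovProd {X : Type*} [MetricSpace X] (e a b : X) : ℝ :=
  (dist a e + dist b e - dist a b) / 2

/-- `X` is `(δ)`-hyperbolic. -/
def IsDeltaHyperbolic (X : Type*) [MetricSpace X] (δ : ℝ) : Prop :=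
  ∀ e a b c : X, gromovProd e a b ≥ min (gromovProd e a c) (gromovProd e b c) - δ

/-- `γ : ℝ → X` restricts to a geodesic from `a` to `b` on `[0, dist a b]`. -/
def IsGeodesicFromTo {X : Type*} [MetricSpace X] (γ : ℝ → X) (a b : X) : Prop :=
  γ 0 = a ∧ γ (dist a b) = b ∧
    ∀ s ∈ Set.Icc (0 : ℝ) (dist a b), ∀ t ∈ Set.Icc (0 : ℝ) (dist a b),
      dist (γ s) (γ t) = |s - t|

/-- Every pair of points of `X` is joined by a geodesic. -/
def IsGeodesicSpace (X : Type*) [MetricSpace X] : Prop :=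
  ∀ a b : X, ∃ γ : ℝ → X, IsGeodesicFromTo γ a b

/-- `f` is metrically proper (relative to the basepoint `e`). -/
def MetricallyProper {Y X : Type*} [MetricSpace Y] [MetricSpace X]
    (f : Y → X) (e : Y) : Prop :=
  ∀ R : ℝ, ∃ S : ℝ, ∀ y : Y, dist (f y) (f e) ≤ R → dist y e ≤ S

/-- `M(N)`: the infimum in `[0,∞]` of the Gromov products `(f x · f y)_{f e}`
over pairs `x, y ∈ Y` with `(x·y)_e ≥ N`.  The infimum of the empty set is `∞`. -/
noncomputable def Mfun {Y X : Type*} [MetricSpace Y] [MetricSpace X]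
    (f : Y → X) (e : Y) (N : ℝ) : ℝ≥0∞ :=
  sInf {p : ℝ≥0∞ | ∃ x y : Y, N ≤ gromovProd e x y ∧
    p = ENNReal.ofReal (gromovProd (f e) (f x) (f y))}

/-- `M'(N)`: the infimum in `[0,∞]` of the distances from `f e` to the images of
geodesics in `X` from `f x` to `f y`, over pairs `x, y ∈ Y` joined by some geodesic
in `Y` whose image avoids the open ball of radius `N` about `e`. -/
noncomputable def M'fun {Y X : Type*} [MetricSpace Y] [MetricSpace X]
    (f : Y → X) (e : Y) (N : ℝ) : ℝ≥0∞ :=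
  sInf {p : ℝ≥0∞ | ∃ x y : Y,
    (∃ γY : ℝ → Y, IsGeodesicFromTo γY x y ∧
      ∀ s ∈ Set.Icc (0 : ℝ) (dist x y), N ≤ dist e (γY s)) ∧
    ∃ γX : ℝ → X, IsGeodesicFromTo γX (f x) (f y) ∧
      p = EMetric.infEdist (f e) (γX '' Set.Icc (0 : ℝ) (dist (f x) (f y)))}

/-- `M''(N)`: the infimum in `[0,∞]` of the distances from `f e` to the images of
geodesics in `X` from `f z` to `f y`, where `y ∈ Y` and `z` is a point with
`dist e z ≥ N` lying on some geodesic in `Y` from `e` to `y`. -/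
noncomputable def M''fun {Y X : Type*} [MetricSpace Y] [MetricSpace X]
    (f : Y → X) (e : Y) (N : ℝ) : ℝ≥0∞ :=
  sInf {p : ℝ≥0∞ | ∃ y z : Y,
    (∃ γY : ℝ → Y, ∃ s ∈ Set.Icc (0 : ℝ) (dist e y),
      IsGeodesicFromTo γY e y ∧ γY s = z) ∧
    N ≤ dist e z ∧
    ∃ γX : ℝ → X, IsGeodesicFromTo γX (f z) (f y) ∧
      p = EMetric.infEdist (f e) (γX '' Set.Icc (0 : ℝ) (dist (f z) (f y)))}

section Hyperbolic

variable {X : Type*} [MetricSpace X] {γ : ℝ → X} {δ : ℝ}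

/-- The four-point form of hyperbolicity. -/
theorem IsDeltaHyperbolic.dist_add_dist_le (h : IsDeltaHyperbolic X δ) (a b c d : X) :
    dist a b + dist c d ≤ max (dist a c + dist b d) (dist b c + dist a d) + 2 * δ := by
  have h4 := h d a b c
  unfold gromovProd at h4
  rcases le_total (dist a c + dist b d) (dist b c + dist a d) with hle | hle
  · rw [max_eq_right hle]
    rw [min_eq_right (by linarith)] at h4
    linarith
  · rw [max_eq_left hle]
    rw [min_eq_left (by linarith)] at h4
    linarith

theorem gromovProd_comm (e a b : X) : gromovProd e a b = gromovProd e b a := by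
  unfold gromovProd
  rw [dist_comm a b]
  ring

theorem gromovProd_nonneg (e a b : X) : 0 ≤ gromovProd e a b := by
  unfold gromovProd
  linarith [dist_triangle_right a b e]

theorem gromovProd_le_dist_left (e a b : X) : gromovProd e a b ≤ dist e a := by
  unfold gromovProd
  linarith [dist_triangle b a e, dist_comm a b, dist_comm a e]

theorem gromovProd_le_dist_right (e a b : X) : gromovProd e a b ≤ dist e b :=
  gromovProd_comm e a b ▸ gromovProd_le_dist_left e b a

theorem IsGeodesicFromTo.dist_left {a b : X} (h : IsGeodesicFromTo γ a b) {s : ℝ}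
    (hs : s ∈ Set.Icc 0 (dist a b)) : dist a (γ s) = s := by
  have h1 := h.2.2 0 ⟨le_rfl, dist_nonneg⟩ s hs
  rwa [h.1, zero_sub, abs_neg, abs_of_nonneg hs.1] at h1

theorem IsGeodesicFromTo.dist_right {a b : X} (h : IsGeodesicFromTo γ a b) {s : ℝ}
    (hs : s ∈ Set.Icc 0 (dist a b)) : dist (γ s) b = dist a b - s := by
  have h1 := h.2.2 s hs (dist a b) ⟨dist_nonneg, le_rfl⟩
  rwa [h.2.1, abs_sub_comm, abs_of_nonneg (sub_nonneg.2 hs.2)] at h1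

/-- A terminal segment of a geodesic is a geodesic. -/
theorem IsGeodesicFromTo.tail {a b : X} (h : IsGeodesicFromTo γ a b) {s : ℝ}
    (hs : s ∈ Set.Icc 0 (dist a b)) : IsGeodesicFromTo (fun u => γ (s + u)) (γ s) b := by
  have hd := h.dist_right hs
  refine ⟨by simp, ?_, fun u hu v hv => ?_⟩
  · simp only [hd, add_sub_cancel, h.2.1]
  · rw [hd] at hu hv
    rw [h.2.2 _ ⟨by linarith [hs.1, hu.1], by linarith [hu.2]⟩ _
      ⟨by linarith [hs.1, hv.1], by linarith [hv.2]⟩, add_sub_add_left_eq_sub]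

/-- The Gromov product is a lower bound for the distance to a geodesic. -/
theorem IsGeodesicFromTo.gromovProd_le_dist {a b : X} (h : IsGeodesicFromTo γ a b) (e : X)
    {s : ℝ} (hs : s ∈ Set.Icc 0 (dist a b)) : gromovProd e a b ≤ dist e (γ s) := by
  unfold gromovProd
  linarith [h.dist_left hs, h.dist_right hs, dist_triangle a (γ s) e, dist_triangle b (γ s) e,
    dist_comm b (γ s), dist_comm e (γ s)]

/-- In a hyperbolic space, the distance to a geodesic exceeds the Gromov product by at
most `2δ`. -/
theorem IsGeodesicFromTo.exists_dist_le {a b : X} (h : IsGeodesicFromTo γ a b)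
    (hX : IsDeltaHyperbolic X δ) (e : X) :
    ∃ s ∈ Set.Icc 0 (dist a b), dist e (γ s) ≤ gromovProd e a b + 2 * δ := by
  have hs : gromovProd a e b ∈ Set.Icc 0 (dist a b) :=
    ⟨gromovProd_nonneg _ _ _, gromovProd_le_dist_right _ _ _⟩
  refine ⟨_, hs, ?_⟩
  have h1 := h.dist_left hs
  have h2 := h.dist_right hs
  have h3 := hX.dist_add_dist_le e (γ (gromovProd a e b)) a b
  have h4 : dist e a + dist (γ (gromovProd a e b)) b = dist a b + gromovProd e a b := by
    rw [h2]
    unfold gromovProd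
    linarith [dist_comm a b, dist_comm a e, dist_comm b e]
  have h5 : dist (γ (gromovProd a e b)) a + dist e b = dist a b + gromovProd e a b := by
    rw [dist_comm _ a, h1]
    unfold gromovProd
    linarith [dist_comm a b, dist_comm a e, dist_comm b e]
  rw [h4, h5, max_self] at h3
  linarith

/-- Geodesics issuing from `e` towards `x` and `y` stay `4δ`-close up to time `(x·y)_e`. -/
theorem IsDeltaHyperbolic.dist_geodesics_le (hX : IsDeltaHyperbolic X δ) (hδ : 0 ≤ δ)
    {e x y : X} {γ' : ℝ → X} (hx : IsGeodesicFromTo γ e x) (hy : IsGeodesicFromTo γ' e y) :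
    dist (γ (gromovProd e x y)) (γ' (gromovProd e x y)) ≤ 4 * δ := by
  have htx : gromovProd e x y ∈ Set.Icc 0 (dist e x) :=
    ⟨gromovProd_nonneg _ _ _, gromovProd_le_dist_left _ _ _⟩
  have hty : gromovProd e x y ∈ Set.Icc 0 (dist e y) :=
    ⟨gromovProd_nonneg _ _ _, gromovProd_le_dist_right _ _ _⟩
  have hx1 := hx.dist_left htx
  have hx2 := hx.dist_right htx
  have hy1 := hy.dist_left hty
  have hy2 := hy.dist_right hty
  have h1 := hX e (γ (gromovProd e x y)) (γ' (gromovProd e x y)) x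
  have h2 := hX e (γ' (gromovProd e x y)) x y
  set t := gromovProd e x y
  have e1 : gromovProd e (γ t) x = t := by
    unfold gromovProd
    linarith [dist_comm x e, dist_comm (γ t) e]
  have e2 : gromovProd e (γ' t) y = t := by
    unfold gromovProd
    linarith [dist_comm y e, dist_comm (γ' t) e]
  rw [e2, min_self] at h2
  have h3 : t - δ ≤ min (gromovProd e (γ t) x) (gromovProd e (γ' t) x) :=
    le_min (by linarith) h2
  have h4 : gromovProd e (γ t) (γ' t) = t - dist (γ t) (γ' t) / 2 := by
    unfold gromovProd
    linarith [dist_comm (γ t) e, dist_comm (γ' t) e]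
  linarith

theorem ofReal_le_infEdist_image {e : X} {s : Set ℝ} {R : ℝ}
    (h : ∀ u ∈ s, R ≤ dist e (γ u)) :
    ENNReal.ofReal R ≤ Metric.infEDist e (γ '' s) := by
  rw [Metric.le_infEDist]
  rintro _ ⟨u, hu, rfl⟩
  rw [edist_dist]
  exact ENNReal.ofReal_le_ofReal (h u hu)

theorem le_dist_of_ofReal_le_infEdist_image {e : X} {s : Set ℝ} {R : ℝ}
    (h : ENNReal.ofReal R ≤ Metric.infEDist e (γ '' s)) {u : ℝ} (hu : u ∈ s) :
    R ≤ dist e (γ u) := by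
  have h1 := Metric.le_infEDist.1 h _ ⟨u, hu, rfl⟩
  rw [edist_dist] at h1
  exact (ENNReal.ofReal_le_ofReal_iff dist_nonneg).1 h1

end Hyperbolic

theorem tendsto_nhds_top_iff_eventually_ofReal_le {F : ℝ → ℝ≥0∞} :
    Tendsto F atTop (nhds ⊤) ↔ ∀ R : ℝ, ∀ᶠ N in atTop, ENNReal.ofReal R ≤ F N := by
  rw [ENNReal.tendsto_nhds_top_iff_nnreal]
  refine ⟨fun h R => (h R.toNNReal).mono fun _ hN => hN.le, fun h r => ?_⟩
  refine (h (r + 1)).mono fun N hN => lt_of_lt_of_le ?_ hN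
  rw [ENNReal.ofReal, ENNReal.coe_lt_coe, ← NNReal.coe_lt_coe,
    Real.coe_toNNReal _ (by positivity)]
  exact lt_add_one _

section Comparison

variable {Y X : Type*} [MetricSpace Y] [MetricSpace X] {f : Y → X} {e : Y}

theorem M'fun_le_M''fun (f : Y → X) (e : Y) (N : ℝ) : M'fun f e N ≤ M''fun f e N := by
  refine sInf_le_sInf ?_
  rintro p ⟨y, _, ⟨γ, s, hs, hγ, rfl⟩, hN, hX⟩
  refine ⟨γ s, y, ⟨_, hγ.tail hs, fun u hu => ?_⟩, hX⟩
  rw [hγ.dist_right hs] at hu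
  have hsu : s + u ∈ Set.Icc 0 (dist e y) :=
    ⟨by linarith [hs.1, hu.1], by linarith [hu.2]⟩
  rw [hγ.dist_left hs] at hN
  rw [hγ.dist_left hsu]
  linarith [hu.1]

/-- A lower bound on `M''(N)` bounds from below the Gromov product of the images of a point `y`
and of a point of a geodesic from `e` to `y` at distance at least `N` from `e`. -/
theorem le_gromovProd_of_le_M''fun {δ N R : ℝ} (hgeo : IsGeodesicSpace X)
    (hX : IsDeltaHyperbolic X δ) (hM : ENNReal.ofReal R ≤ M''fun f e N) {y : Y} {γ : ℝ → Y}
    (hγ : IsGeodesicFromTo γ e y) {s : ℝ} (hs : s ∈ Set.Icc 0 (dist e y)) (hN : N ≤ s) :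
    R ≤ dist (f e) (f (γ s)) ∧ R - 2 * δ ≤ gromovProd (f e) (f (γ s)) (f y) := by
  obtain ⟨γX, hγX⟩ := hgeo (f (γ s)) (f y)
  have hle : ENNReal.ofReal R ≤ Metric.infEDist (f e)
      (γX '' Set.Icc (0 : ℝ) (dist (f (γ s)) (f y))) :=
    hM.trans (sInf_le ⟨y, γ s, ⟨γ, s, hs, hγ, rfl⟩, by rwa [hγ.dist_left hs], γX, hγX, rfl⟩)
  obtain ⟨u, hu, hdu⟩ := hγX.exists_dist_le hX (f e)
  refine ⟨?_, by linarith [le_dist_of_ofReal_le_infEdist_image hle hu]⟩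
  have h0 := le_dist_of_ofReal_le_infEdist_image hle ⟨le_rfl, dist_nonneg⟩
  rwa [hγX.1] at h0

theorem ofReal_le_M'fun {δX δY B N R : ℝ} (hgeoY : IsGeodesicSpace Y)
    (hgeoX : IsGeodesicSpace X) (hδY : 0 ≤ δY) (hδX : 0 ≤ δX)
    (hhypY : IsDeltaHyperbolic Y δY) (hhypX : IsDeltaHyperbolic X δX)
    (hB : ∀ x y : Y, dist x y ≤ 4 * δY → dist (f x) (f y) ≤ B)
    (hM : ENNReal.ofReal (R + 4 * δX + B) ≤ M''fun f e N) :
    ENNReal.ofReal R ≤ M'fun f e (N + 2 * δY) := by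
  refine le_sInf ?_
  rintro p ⟨x, y, ⟨γ, hγ, hfar⟩, γX, hγX, rfl⟩
  refine ofReal_le_infEdist_image fun u hu => le_trans ?_ (hγX.gromovProd_le_dist (f e) hu)
  obtain ⟨s, hs, hds⟩ := hγ.exists_dist_le hhypY e
  have hN : N ≤ gromovProd e x y := by linarith [hfar s hs]
  obtain ⟨γx, hx⟩ := hgeoY e x
  obtain ⟨γy, hy⟩ := hgeoY e y
  have hclose := hB _ _ (hhypY.dist_geodesics_le hδY hx hy)
  obtain ⟨hx1, hx2⟩ := le_gromovProd_of_le_M''fun hgeoX hhypX hM hx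
    ⟨gromovProd_nonneg _ _ _, gromovProd_le_dist_left _ _ _⟩ hN
  obtain ⟨hy1, hy2⟩ := le_gromovProd_of_le_M''fun hgeoX hhypX hM hy
    ⟨gromovProd_nonneg _ _ _, gromovProd_le_dist_right _ _ _⟩ hN
  set x' := f (γx (gromovProd e x y))
  set y' := f (γy (gromovProd e x y))
  have hB0 : 0 ≤ B := dist_nonneg.trans hclose
  have hxy' : R + 4 * δX ≤ gromovProd (f e) y' x' := by
    unfold gromovProd
    linarith [dist_comm y' (f e), dist_comm x' (f e), dist_comm x' y']
  rw [gromovProd_comm] at hx2 hy2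
  have h1 := hhypX (f e) (f y) x' y'
  rw [gromovProd_comm (f e) x' y'] at h1
  have h2 : R + 2 * δX ≤ min (gromovProd (f e) (f y) y') (gromovProd (f e) y' x') :=
    le_min (by linarith) (by linarith)
  have h3 : R + δX ≤ min (gromovProd (f e) (f x) x') (gromovProd (f e) (f y) x') :=
    le_min (by linarith) (by linarith)
  linarith [hhypX (f e) (f x) (f y) x']

end Comparison

theorem stmt3 {Y X : Type*} [MetricSpace Y] [MetricSpace X]
    [ProperSpace Y] [ProperSpace X]
    (hgeoY : IsGeodesicSpace Y) (hgeoX : IsGeodesicSpace X)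
    (δY δX : ℝ) (hδY : 0 ≤ δY) (hδX : 0 ≤ δX)
    (hhypY : IsDeltaHyperbolic Y δY) (hhypX : IsDeltaHyperbolic X δX)
    (f : Y → X) (e : Y) (hf : MetricallyProper f e)
    (hbdd : ∀ r : ℝ, 0 ≤ r → ∃ B : ℝ, ∀ x y : Y, dist x y ≤ r → dist (f x) (f y) ≤ B) :
    Tendsto (M'fun f e) atTop (nhds ⊤) ↔ Tendsto (M''fun f e) atTop (nhds ⊤) := by
  refine ⟨fun h => tendsto_nhds_top_mono' h (M'fun_le_M''fun f e), fun h => ?_⟩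
  rw [tendsto_nhds_top_iff_eventually_ofReal_le] at h ⊢
  intro R
  obtain ⟨B, hB⟩ := hbdd (4 * δY) (by positivity)
  have h1 := (tendsto_atTop_add_const_right atTop (-(2 * δY)) tendsto_id).eventually
    (h (R + 4 * δX + B))
  refine h1.mono fun N hN => ?_
  have h2 := ofReal_le_M'fun hgeoY hgeoX hδY hδX hhypY hhypX hB hN
  rwa [id, neg_add_cancel_right] at h2
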